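/- Let τ : 𝔤 → Hom(V, W) be a tableau map with image 𝔥 = range τ. Then τ is involutive (i.e., there exists a basis e₁,…,e_n of V with dim 𝔤⁽¹⁾ = Σ_{k=0}^{n−1} dim 𝔤_k) if and only if the classical tableau 𝔥 = range τ is involutive (i.e., there exists a basis e₁,…,e_n of V with dim 𝔥⁽¹⁾ = Σ_{k=0}^{n−1} dim 𝔥_k). -/

import Mathlib

open Module Submodule

variable {𝔤 V W : Type} [AddCommGroup 𝔤] [Module ℝ 𝔤]
  [AddCommGroup V] [Module ℝ V] [AddCommGroup W] [Module ℝ W]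

/-- The first prolongation `𝔤⁽¹⁾` of a tableau map `τ : 𝔤 → Hom(V, W)`:
the kernel of the Spencer differential. -/
def tableauMapProlong (τ : 𝔤 →ₗ[ℝ] V →ₗ[ℝ] W) : Submodule ℝ (V →ₗ[ℝ] 𝔤) where
  carrier := {ξ | ∀ v w, τ (ξ v) w = τ (ξ w) v}
  add_mem' := by
    intro a b ha hb v w
    simp only [LinearMap.add_apply, map_add]
    rw [ha v w, hb v w]
  zero_mem' := by intro v w; simp
  smul_mem' := by
    intro c a ha v w
    simp only [LinearMap.smul_apply, map_smul]
    rw [ha v w]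

/-- The first prolongation `𝔥⁽¹⁾` of a classical tableau `𝔥 ⊆ Hom(V, W)`,
realized as the symmetric `𝔥`-valued elements of `Hom(V, Hom(V, W))`. -/
def tableauProlong (𝔥 : Submodule ℝ (V →ₗ[ℝ] W)) :
    Submodule ℝ (V →ₗ[ℝ] (V →ₗ[ℝ] W)) where
  carrier := {η | (∀ v, η v ∈ 𝔥) ∧ ∀ v w, η v w = η w v}
  add_mem' := by
    rintro a b ⟨ha1, ha2⟩ ⟨hb1, hb2⟩
    refine ⟨fun v => ?_, fun v w => ?_⟩
    · simpa using 𝔥.add_mem (ha1 v) (hb1 v)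
    · simp only [LinearMap.add_apply]
      rw [ha2 v w, hb2 v w]
  zero_mem' := ⟨fun v => by simp, fun v w => by simp⟩
  smul_mem' := by
    rintro c a ⟨ha1, ha2⟩
    refine ⟨fun v => ?_, fun v w => ?_⟩
    · simpa using 𝔥.smul_mem c (ha1 v)
    · simp only [LinearMap.smul_apply]
      rw [ha2 v w]

/-- Linear maps from `V` vanishing on a subspace `Vk ⊆ V`. -/
def vanishingOn (M : Type) [AddCommGroup M] [Module ℝ M] (Vk : Submodule ℝ V) :
    Submodule ℝ (V →ₗ[ℝ] M) where
  carrier := {ξ | ∀ v ∈ Vk, ξ v = 0}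
  add_mem' := by
    intro a b ha hb v hv
    simp [ha v hv, hb v hv]
  zero_mem' := by intro v hv; simp
  smul_mem' := by
    intro c a ha v hv
    simp [ha v hv]

/-- The `k`-th member `V_k = span(e₁, …, e_k)` of the flag associated to a basis. -/
def flagSub {n : ℕ} (e : Basis (Fin n) ℝ V) (k : ℕ) : Submodule ℝ V :=
  Submodule.span ℝ (e '' {i : Fin n | (i : ℕ) < k})

/-- The pushforward `τ_* : Hom(V, 𝔤) → Hom(V, Hom(V, W))`, `ξ ↦ τ ∘ ξ`. -/
def pushforward (τ : 𝔤 →ₗ[ℝ] V →ₗ[ℝ] W) :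
    (V →ₗ[ℝ] 𝔤) →ₗ[ℝ] (V →ₗ[ℝ] (V →ₗ[ℝ] W)) :=
  LinearMap.llcomp ℝ V 𝔤 (V →ₗ[ℝ] W) τ

/-- The preimage of a subspace has the dimension of its trace on the range plus that of the
kernel. -/
theorem finrank_comap_eq {M N : Type} [AddCommGroup M] [Module ℝ M] [AddCommGroup N] [Module ℝ N]
    [FiniteDimensional ℝ M] (f : M →ₗ[ℝ] N) (p : Submodule ℝ N) :
    finrank ℝ (p.comap f) =
      finrank ℝ ↥(LinearMap.range f ⊓ p) + finrank ℝ (LinearMap.ker f) := by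
  have h := (f.domRestrict (p.comap f)).finrank_range_add_finrank_ker
  rw [LinearMap.range_domRestrict, Submodule.map_comap_eq, LinearMap.ker_domRestrict] at h
  rw [← h, (Submodule.comapSubtypeEquivOfLe (LinearMap.ker_le_comap f)).finrank_eq]

theorem mem_tableauProlong {𝔥 : Submodule ℝ (V →ₗ[ℝ] W)} {η : V →ₗ[ℝ] V →ₗ[ℝ] W} :
    η ∈ tableauProlong 𝔥 ↔ (∀ v, η v ∈ 𝔥) ∧ ∀ v w, η v w = η w v :=
  Iff.rfl

theorem tableauMapProlong_eq_comap (τ : 𝔤 →ₗ[ℝ] V →ₗ[ℝ] W) :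
    tableauMapProlong τ = (tableauProlong ⊤).comap (pushforward τ) := by
  ext ξ
  exact ⟨fun h => ⟨fun _ => trivial, h⟩, fun h => h.2⟩

theorem mem_range_pushforward (τ : 𝔤 →ₗ[ℝ] V →ₗ[ℝ] W) (η : V →ₗ[ℝ] V →ₗ[ℝ] W) :
    η ∈ LinearMap.range (pushforward τ) ↔ ∀ v, η v ∈ LinearMap.range τ := by
  constructor
  · rintro ⟨ξ, rfl⟩ v
    exact ⟨ξ v, rfl⟩
  · intro h
    obtain ⟨s, hs⟩ := τ.rangeRestrict.exists_rightInverse_of_surjective τ.range_rangeRestrict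
    refine ⟨s ∘ₗ η.codRestrict _ h, LinearMap.ext fun v => ?_⟩
    exact congrArg Subtype.val (LinearMap.congr_fun hs (η.codRestrict _ h v))

theorem range_pushforward_inf (τ : 𝔤 →ₗ[ℝ] V →ₗ[ℝ] W) :
    LinearMap.range (pushforward τ) ⊓ tableauProlong ⊤ = tableauProlong (LinearMap.range τ) := by
  ext η
  rw [Submodule.mem_inf, mem_range_pushforward, mem_tableauProlong, mem_tableauProlong]
  simp

theorem ker_pushforward (τ : 𝔤 →ₗ[ℝ] V →ₗ[ℝ] W) :
    LinearMap.ker (pushforward τ) =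
      LinearMap.range (LinearMap.compRight ℝ (M := V) (LinearMap.ker τ).subtype) := by
  ext ξ
  constructor
  · intro h
    exact ⟨ξ.codRestrict _ fun v => LinearMap.congr_fun h v, rfl⟩
  · rintro ⟨ζ, rfl⟩
    exact LinearMap.ext fun v => (ζ v).2

theorem finrank_ker_pushforward [FiniteDimensional ℝ 𝔤] [FiniteDimensional ℝ V]
    (τ : 𝔤 →ₗ[ℝ] V →ₗ[ℝ] W) :
    finrank ℝ (LinearMap.ker (pushforward τ)) =
      finrank ℝ V * finrank ℝ (LinearMap.ker τ) := by
  rw [ker_pushforward, LinearMap.finrank_range_of_inj, Module.finrank_linearMap]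
  intro a b h
  exact LinearMap.ext fun v => Subtype.ext (LinearMap.congr_fun h v)

theorem finrank_tableauMapProlong [FiniteDimensional ℝ 𝔤] [FiniteDimensional ℝ V]
    (τ : 𝔤 →ₗ[ℝ] V →ₗ[ℝ] W) :
    finrank ℝ (tableauMapProlong τ) =
      finrank ℝ (tableauProlong (LinearMap.range τ)) +
        finrank ℝ V * finrank ℝ (LinearMap.ker τ) := by
  rw [tableauMapProlong_eq_comap, finrank_comap_eq, range_pushforward_inf,
    finrank_ker_pushforward]

/-- a tableau map `τ` is involutive iff the classical tableau
`𝔥 = range τ` is involutive. -/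
theorem tableauMap_involutive_iff
    [FiniteDimensional ℝ 𝔤] [FiniteDimensional ℝ V] [FiniteDimensional ℝ W]
    (τ : 𝔤 →ₗ[ℝ] V →ₗ[ℝ] W) :
    (∃ e : Basis (Fin (finrank ℝ V)) ℝ V,
        finrank ℝ (tableauMapProlong τ) =
          ∑ k ∈ Finset.range (finrank ℝ V),
            finrank ℝ ((vanishingOn W (flagSub e k)).comap τ)) ↔
    (∃ e : Basis (Fin (finrank ℝ V)) ℝ V,
        finrank ℝ (tableauProlong (LinearMap.range τ)) =
          ∑ k ∈ Finset.range (finrank ℝ V),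
            finrank ℝ ↥(LinearMap.range τ ⊓ vanishingOn W (flagSub e k))) := by
  refine exists_congr fun e => ?_
  simp_rw [finrank_tableauMapProlong, finrank_comap_eq, Finset.sum_add_distrib,
    Finset.sum_const, Finset.card_range, smul_eq_mul, Nat.add_right_cancel_iff]
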